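/- Let ψ* ↦ E(ψ*) assign to each ψ* ∈ Ψ a measurable subset of 𝒳 such that {(ψ*, x) : x ∈ E(ψ*)} is product-measurable, and let A(ψ*) = {x : m_{ψ*}(x) ≥ m(x)}. (i) If Π({ψ}) = 0 for every ψ ∈ Ψ and M_{ψ*}(E(ψ*)) ≥ M_{ψ*}(A(ψ*)) for every ψ*, then ∫_Ψ ∫_{Ψ∖{ψ*}} M_ψ(E(ψ*)) Π(dψ) Π(dψ*) ≥ ∫_Ψ ∫_{Ψ∖{ψ*}} M_ψ(A(ψ*)) Π(dψ) Π(dψ*); that is, the plausible region Pl minimizes the prior probability of covering a false value. (ii) For an arbitrary prior Π, the same double-integral inequality holds provided M_{ψ*}(E(ψ*)) = M_{ψ*}(A(ψ*)) for every ψ*. -/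

import Mathlib

open MeasureTheory
open scoped ENNReal

/-- Neyman-Pearson comparison: if `{x | g x ≤ f x}` has no more `f`-mass than `S`, then it has no
more `g`-mass than `S`. -/
theorem withDensity_setOf_le_le_of_withDensity_le {X : Type*} [MeasurableSpace X]
    {μ : Measure X} {f g : X → ℝ≥0∞} (hf : Measurable f) (hg : Measurable g)
    [IsFiniteMeasure (μ.withDensity f)] {S : Set X} (hS : MeasurableSet S)
    (h : μ.withDensity f {x | g x ≤ f x} ≤ μ.withDensity f S) :
    μ.withDensity g {x | g x ≤ f x} ≤ μ.withDensity g S := by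
  set A : Set X := {x | g x ≤ f x} with hA
  have hAm : MeasurableSet A := measurableSet_le hg hf
  have hdiff : μ.withDensity f (A \ S) ≤ μ.withDensity f (S \ A) := by
    rw [← measure_inter_add_sdiff A hS, ← measure_inter_add_sdiff S hAm, Set.inter_comm S A] at h
    exact (ENNReal.add_le_add_iff_left (measure_ne_top _ _)).1 h
  have hle : μ.withDensity g (A \ S) ≤ μ.withDensity f (A \ S) := by
    rw [withDensity_apply _ (hAm.diff hS), withDensity_apply _ (hAm.diff hS)]
    exact setLIntegral_mono hf fun x hx => hx.1
  have hge : μ.withDensity f (S \ A) ≤ μ.withDensity g (S \ A) := by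
    rw [withDensity_apply _ (hS.diff hAm), withDensity_apply _ (hS.diff hAm)]
    exact setLIntegral_mono hg fun x hx => (not_le.1 hx.2).le
  rw [← measure_inter_add_sdiff A hS, ← measure_inter_add_sdiff S hAm, Set.inter_comm S A]
  refine add_le_add le_rfl ?_
  exact hle.trans (hdiff.trans hge)

theorem lintegral_withDensity_apply_eq {X Ψ : Type*} [MeasurableSpace X] [MeasurableSpace Ψ]
    (μ : Measure X) [SFinite μ] (ν : Measure Ψ) [SFinite ν] {m : Ψ → X → ℝ≥0∞}
    (hm : Measurable (Function.uncurry m)) {S : Set X} (hS : MeasurableSet S) :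
    ∫⁻ ψ, μ.withDensity (m ψ) S ∂ν = μ.withDensity (fun x => ∫⁻ ψ, m ψ x ∂ν) S := by
  simp_rw [withDensity_apply _ hS]
  exact lintegral_lintegral_swap hm.aemeasurable

/-- The complement of a non-measurable singleton has full restriction. -/
theorem restrict_compl_singleton_of_not_measurableSet {Ψ : Type*} [MeasurableSpace Ψ]
    (ν : Measure Ψ) [SFinite ν] {a : Ψ} (ha : ¬ MeasurableSet ({a} : Set Ψ)) :
    ν.restrict {a}ᶜ = ν := by
  have hT : toMeasurable ν {a}ᶜ = Set.univ := by
    by_contra hne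
    obtain ⟨b, hb⟩ := (Set.ne_univ_iff_exists_notMem _).1 hne
    have hsub := subset_toMeasurable ν ({a}ᶜ : Set Ψ)
    have hba : b = a := by
      by_contra hba
      exact hb (hsub hba)
    subst hba
    have heq : toMeasurable ν {b}ᶜ = {b}ᶜ :=
      (Set.subset_compl_singleton_iff.2 hb).antisymm hsub
    exact ha (MeasurableSet.compl_iff.1 (heq ▸ measurableSet_toMeasurable ν {b}ᶜ))
  rw [← Measure.restrict_toMeasurable_of_sFinite, hT, Measure.restrict_univ]

theorem setLIntegral_compl_singleton_le {Ψ : Type*} [MeasurableSpace Ψ]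
    (ν : Measure Ψ) [IsFiniteMeasure ν] {a : Ψ} {f g : Ψ → ℝ≥0∞} (hfa : f a ≠ ∞)
    (hfg : f a = g a) (h : ∫⁻ ψ, f ψ ∂ν ≤ ∫⁻ ψ, g ψ ∂ν) :
    ∫⁻ ψ in {a}ᶜ, f ψ ∂ν ≤ ∫⁻ ψ in {a}ᶜ, g ψ ∂ν := by
  by_cases ha : MeasurableSet ({a} : Set Ψ)
  · have hconst : ∀ k : Ψ → ℝ≥0∞, ∫⁻ ψ in {a}, k ψ ∂ν = k a * ν {a} := fun k => by
      rw [setLIntegral_congr_fun (g := fun _ => k a) ha (by rintro x rfl; rfl),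
        setLIntegral_const]
    rw [← lintegral_add_compl f ha, ← lintegral_add_compl g ha, hconst, hconst, ← hfg] at h
    exact (ENNReal.add_le_add_iff_left (ENNReal.mul_ne_top hfa (measure_ne_top _ _))).1 h
  · rwa [restrict_compl_singleton_of_not_measurableSet ν ha]

/-- **Theorem 5(ii)** (Evans–Guo): the plausible region minimizes the prior probability of
covering a false value. For a product-measurable family of rules `E(ψ*)` with
`A(ψ*) = {x | m_{ψ*}(x) ≥ m(x)}`: (i) if `Π({ψ}) = 0` for every `ψ` and
`M_{ψ*}(E(ψ*)) ≥ M_{ψ*}(A(ψ*))` for every `ψ*`, then the double integral over false values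
of the coverage probability is minimized by `A`; (ii) for an arbitrary prior, the same holds
provided `M_{ψ*}(E(ψ*)) = M_{ψ*}(A(ψ*))` for every `ψ*`. -/
theorem plausible_region_minimizes_prob_covering_false_value
    {X Ψ : Type*} [MeasurableSpace X] [MeasurableSpace Ψ]
    (μ : Measure X) [SigmaFinite μ]
    (Pr : Measure Ψ) [IsProbabilityMeasure Pr]
    (m : Ψ → X → ℝ≥0∞) (hm : Measurable (Function.uncurry m))
    (hprob : ∀ ψ, IsProbabilityMeasure (μ.withDensity (m ψ)))
    (mbar : X → ℝ≥0∞) (hmbar : ∀ x, mbar x = ∫⁻ ψ, m ψ x ∂Pr)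
    (E : Ψ → Set X) (hEmeas : MeasurableSet {p : Ψ × X | p.2 ∈ E p.1}) :
    ((∀ ψ : Ψ, Pr {ψ} = 0) →
      (∀ ψs, μ.withDensity (m ψs) {x | mbar x ≤ m ψs x} ≤
        μ.withDensity (m ψs) (E ψs)) →
      ∫⁻ ψs, ∫⁻ ψ in {ψs}ᶜ, μ.withDensity (m ψ) {x | mbar x ≤ m ψs x} ∂Pr ∂Pr ≤
        ∫⁻ ψs, ∫⁻ ψ in {ψs}ᶜ, μ.withDensity (m ψ) (E ψs) ∂Pr ∂Pr) ∧
    ((∀ ψs, μ.withDensity (m ψs) (E ψs) =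
        μ.withDensity (m ψs) {x | mbar x ≤ m ψs x}) →
      ∫⁻ ψs, ∫⁻ ψ in {ψs}ᶜ, μ.withDensity (m ψ) {x | mbar x ≤ m ψs x} ∂Pr ∂Pr ≤
        ∫⁻ ψs, ∫⁻ ψ in {ψs}ᶜ, μ.withDensity (m ψ) (E ψs) ∂Pr ∂Pr) := by
  obtain rfl : mbar = fun x => ∫⁻ ψ, m ψ x ∂Pr := funext hmbar
  have hmb : Measurable fun x => ∫⁻ ψ, m ψ x ∂Pr := hm.lintegral_prod_left'
  have hmψ : ∀ ψ, Measurable (m ψ) := fun ψ => hm.comp measurable_prodMk_left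
  have hE : ∀ ψs, MeasurableSet (E ψs) := fun ψs => measurable_prodMk_left hEmeas
  have key : ∀ ψs,
      μ.withDensity (m ψs) {x | ∫⁻ ψ, m ψ x ∂Pr ≤ m ψs x} ≤ μ.withDensity (m ψs) (E ψs) →
      ∫⁻ ψ, μ.withDensity (m ψ) {x | ∫⁻ ψ, m ψ x ∂Pr ≤ m ψs x} ∂Pr ≤
        ∫⁻ ψ, μ.withDensity (m ψ) (E ψs) ∂Pr := fun ψs h => by
    rw [lintegral_withDensity_apply_eq μ Pr hm (measurableSet_le hmb (hmψ ψs)),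
      lintegral_withDensity_apply_eq μ Pr hm (hE ψs)]
    exact withDensity_setOf_le_le_of_withDensity_le (hmψ ψs) hmb (hE ψs) h
  refine ⟨fun h0 h => lintegral_mono fun ψs => ?_, fun h => lintegral_mono fun ψs => ?_⟩
  · have hr : Pr.restrict {ψs}ᶜ = Pr :=
      Measure.restrict_eq_self_of_ae_mem (measure_eq_zero_iff_ae_notMem.1 (h0 ψs))
    simpa only [hr] using key ψs (h ψs)
  · exact setLIntegral_compl_singleton_le Pr (measure_ne_top _ _) (h ψs).symm
      (key ψs (h ψs).ge)
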